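/- In a connected weighted graph G with weighted Laplacian pseudo-inverse L^†, an edge ℓ = (i, j) with weight b_ℓ is a bridge if and only if the effective resistance satisfies R_{ij} = L^†_{ii} + L^†_{jj} − 2 L^†_{ij} = 1 / b_ℓ (equivalently, D_{ℓℓ} = b_ℓ R_{ij} = 1). -/

import Mathlib

open Finset Matrix

lemma br_mulVec {V : Type*} [Fintype V] [DecidableEq V]
    (b : V → V → ℝ) (x : V → ℝ) (a : V) :
    ((Matrix.of fun i j =>
      if i = j then ∑ k ∈ Finset.univ.erase i, b i k else - b i j) *ᵥ x) a
      = ∑ k, b a k * (x a - x k) := by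
  simp only [mulVec, dotProduct, Matrix.of_apply]
  rw [← Finset.add_sum_erase _ _ (Finset.mem_univ a),
    ← Finset.add_sum_erase (s := Finset.univ) (fun k => b a k * (x a - x k)) (Finset.mem_univ a)]
  simp only [if_true, sub_self, mul_zero, zero_add]
  rw [Finset.sum_mul, ← Finset.sum_add_distrib]
  apply Finset.sum_congr rfl
  intro k hk
  rw [if_neg (Finset.ne_of_mem_erase hk).symm]
  ring

lemma br_energy {V : Type*} [Fintype V]
    (b : V → V → ℝ) (hsymm : ∀ i j, b i j = b j i) (x : V → ℝ) :
    ∑ a, ∑ k, b a k * (x a - x k) ^ 2 = 2 * ∑ a, x a * ∑ k, b a k * (x a - x k) := by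
  have h : ∑ a, x a * ∑ k, b a k * (x a - x k)
      = ∑ a, ∑ k, x k * (b a k * (x k - x a)) := by
    rw [Finset.sum_comm]
    apply Finset.sum_congr rfl
    intro a _
    rw [Finset.mul_sum]
    apply Finset.sum_congr rfl
    intro k _
    rw [hsymm a k]
  rw [two_mul]
  nth_rewrite 2 [h]
  rw [← Finset.sum_add_distrib]
  apply Finset.sum_congr rfl
  intro a _
  rw [Finset.mul_sum, ← Finset.sum_add_distrib]
  apply Finset.sum_congr rfl
  intro k _
  ring

lemma br_reach {V : Type*} (H : SimpleGraph V) (f : V → ℝ)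
    (h : ∀ a k, H.Adj a k → f a = f k) {u v : V} (huv : H.Reachable u v) : f u = f v := by
  obtain ⟨w⟩ := huv
  induction w with
  | nil => rfl
  | cons hab _ ih => exact (h _ _ hab).trans ih

lemma br_bilin {V : Type*} [Fintype V]
    (b : V → V → ℝ) (hsymm : ∀ i j, b i j = b j i) (g x : V → ℝ) :
    ∑ a, ∑ k, b a k * ((g a - g k) * (x a - x k))
      = 2 * ∑ a, g a * ∑ k, b a k * (x a - x k) := by
  have h : ∑ a, g a * ∑ k, b a k * (x a - x k)
      = ∑ a, ∑ k, g k * (b a k * (x k - x a)) := by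
    rw [Finset.sum_comm]
    apply Finset.sum_congr rfl
    intro a _
    rw [Finset.mul_sum]
    apply Finset.sum_congr rfl
    intro k _
    rw [hsymm a k]
  rw [two_mul]
  nth_rewrite 2 [h]
  rw [← Finset.sum_add_distrib]
  apply Finset.sum_congr rfl
  intro a _
  rw [Finset.mul_sum, ← Finset.sum_add_distrib]
  apply Finset.sum_congr rfl
  intro k _
  ring

lemma br_two {V : Type*} [Fintype V] [DecidableEq V] (T : V → V → ℝ) (i j : V) (hij : i ≠ j)
    (h : ∀ a k, s(a, k) ≠ s(i, j) → T a k = 0) :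
    ∑ a, ∑ k, T a k = T i j + T j i := by
  rw [← Fintype.sum_prod_type']
  rw [← Finset.sum_subset (Finset.subset_univ {(i, j), (j, i)})]
  · rw [Finset.sum_pair]
    intro h
    exact hij (congrArg Prod.fst h)
  · rintro ⟨a, k⟩ _ hx
    apply h
    intro h5
    apply hx
    rcases Sym2.eq_iff.mp h5 with ⟨rfl, rfl⟩ | ⟨rfl, rfl⟩ <;> simp

theorem isBridge_iff_effectiveResistance {V : Type*} [Fintype V] [DecidableEq V]
    (G : SimpleGraph V) (hG : G.Connected)
    (b : V → V → ℝ) (hsymm : ∀ i j, b i j = b j i)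
    (hpos : ∀ i j, G.Adj i j → 0 < b i j) (hzero : ∀ i j, ¬ G.Adj i j → b i j = 0)
    (L Ld : Matrix V V ℝ)
    (hL : L = Matrix.of fun i j =>
      if i = j then ∑ k ∈ Finset.univ.erase i, b i k else - b i j)
    (h1 : L * Ld * L = L) (h2 : Ld * L * Ld = Ld)
    (h3 : (L * Ld)ᵀ = L * Ld) (h4 : (Ld * L)ᵀ = Ld * L)
    (i j : V) (hadj : G.Adj i j) :
    G.IsBridge s(i, j) ↔ Ld i i + Ld j j - 2 * Ld i j = 1 / b i j := by
  have hLx : ∀ x a, (L *ᵥ x) a = ∑ k, b a k * (x a - x k) := by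
    intro x a; rw [hL]; exact br_mulVec b x a
  have hLs : Lᵀ = L := by
    ext a k
    rw [Matrix.transpose_apply, hL, Matrix.of_apply, Matrix.of_apply]
    by_cases h : a = k
    · subst h; rfl
    · rw [if_neg h, if_neg (Ne.symm h), hsymm]
  have hb0 : ∀ a k, 0 ≤ b a k := fun a k => by
    by_cases h : G.Adj a k
    · exact (hpos _ _ h).le
    · exact (hzero _ _ h).ge
  -- P and Q agree
  have hLP : L * (L * Ld) = L := by
    have := congrArg Matrix.transpose h1
    rwa [Matrix.transpose_mul, h3, hLs] at this
  have hQL : (Ld * L) * L = L := by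
    have h1' : L * (Ld * L) = L := by rw [← Matrix.mul_assoc]; exact h1
    have := congrArg Matrix.transpose h1'
    rwa [Matrix.transpose_mul, h4, hLs] at this
  have hPQ : L * Ld = Ld * L := by
    calc L * Ld = ((Ld * L) * L) * Ld := by rw [hQL]
      _ = Ld * (L * (L * Ld)) := by simp only [Matrix.mul_assoc]
      _ = Ld * L := by rw [hLP]
  have hLd : Ldᵀ = Ld := by
    have e : Ld = Ldᵀ * L * Ld := by
      have h5 : Ldᵀ * L = L * Ld := by rw [← h3, Matrix.transpose_mul, hLs]
      rw [h5, hPQ, h2]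
    have e2 := congrArg Matrix.transpose e
    rw [Matrix.transpose_mul, Matrix.transpose_mul, Matrix.transpose_transpose, hLs,
      ← Matrix.mul_assoc, ← e] at e2
    exact e2
  -- kernel of L
  have hker : ∀ x : V → ℝ, L *ᵥ x = 0 → ∀ u v, x u = x v := by
    intro x hx u v
    have hE := br_energy b hsymm x
    simp only [← hLx, hx, Pi.zero_apply, mul_zero, Finset.sum_const_zero] at hE
    apply br_reach G x _ (hG.preconnected u v)
    intro a k hak
    rw [Finset.sum_eq_zero_iff_of_nonneg
      (fun a _ => Finset.sum_nonneg fun k _ => mul_nonneg (hb0 a k) (sq_nonneg _))] at hE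
    have h5 := hE a (Finset.mem_univ a)
    rw [Finset.sum_eq_zero_iff_of_nonneg
      (fun k _ => mul_nonneg (hb0 a k) (sq_nonneg _))] at h5
    have h6 := h5 k (Finset.mem_univ k)
    rcases mul_eq_zero.mp h6 with h7 | h7
    · exact absurd h7 (hpos a k hak).ne'
    · exact sub_eq_zero.mp (pow_eq_zero_iff two_ne_zero |>.mp h7)
  -- the potential
  set f : V → ℝ := fun a => Ld a i - Ld a j with hf
  have hfv : ∀ a, ∑ k, b a k * (f a - f k) = (if a = i then 1 else 0) - (if a = j then 1 else 0) := by
    have hz : L * (1 - L * Ld) = 0 := by rw [Matrix.mul_sub, hLP, Matrix.mul_one, sub_self]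
    have hsy : (1 - L * Ld)ᵀ = 1 - L * Ld := by
      rw [Matrix.transpose_sub, h3, Matrix.transpose_one]
    have hcol : ∀ c u v, (1 - L * Ld) u c = (1 - L * Ld) v c := by
      intro c u v
      refine hker (fun r => (1 - L * Ld) r c) ?_ u v
      ext r
      exact congrFun (congrFun hz r) c
    intro a
    rw [← hLx]
    have e1 : (L *ᵥ f) a = (L * Ld) a i - (L * Ld) a j := by
      simp only [mulVec, dotProduct, Matrix.mul_apply, hf, mul_sub, Finset.sum_sub_distrib]
    have e2 : (1 - L * Ld) a i = (1 - L * Ld) a j := by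
      have s : ∀ u v, (1 - L * Ld) u v = (1 - L * Ld) v u := fun u v => congrFun (congrFun hsy v) u
      rw [s a i, s a j]; exact hcol a i j
    rw [Matrix.sub_apply, Matrix.sub_apply, Matrix.one_apply, Matrix.one_apply] at e2
    rw [e1]; linarith
  have hR : Ld i i + Ld j j - 2 * Ld i j = f i - f j := by
    have : Ld j i = Ld i j := congrFun (congrFun hLd i) j
    simp only [hf, this]; ring
  rw [hR]
  have hbij := hpos i j hadj
  have hij : i ≠ j := hadj.ne
  rw [eq_div_iff hbij.ne', SimpleGraph.isBridge_iff]
  constructor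
  · intro hbr
    classical
    set H := G.deleteEdges {s(i, j)} with hH
    let g : V → ℝ := fun a => if H.Reachable i a then 1 else 0
    have hgi : g i = 1 := if_pos (SimpleGraph.Reachable.refl i)
    have hgj : g j = 0 := if_neg hbr
    have hB := br_bilin b hsymm g f
    simp only [hfv] at hB
    rw [br_two _ i j hij] at hB
    · simp [mul_sub, Finset.sum_sub_distrib, hgi, hgj] at hB
      rw [hsymm j i] at hB
      linarith
    · intro a k hak
      by_cases hA : G.Adj a k
      · have hHa : H.Adj a k := by
          rw [hH, SimpleGraph.deleteEdges_adj]
          exact ⟨hA, hak⟩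
        have : g a = g k := by
          have h5 : H.Reachable i a ↔ H.Reachable i k :=
            ⟨fun h => h.trans hHa.reachable, fun h => h.trans hHa.symm.reachable⟩
          simp only [g, h5]
        rw [this]; ring
      · rw [hzero a k hA]; ring
  · intro hbR hreach
    have hE' : ∑ a, ∑ k, b a k * (f a - f k) ^ 2 = 2 * (f i - f j) := by
      have h6 := br_energy b hsymm f
      simp only [hfv] at h6
      rw [h6]
      simp [mul_sub, Finset.sum_sub_distrib]
    have hT := br_two (fun a k => if s(a, k) = s(i, j) then b a k * (f a - f k) ^ 2 else 0) i j hij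
      (fun a k h => if_neg h)
    rw [if_pos rfl, if_pos Sym2.eq_swap, hsymm j i] at hT
    have hS : ∑ a, ∑ k, (b a k * (f a - f k) ^ 2 -
        (if s(a, k) = s(i, j) then b a k * (f a - f k) ^ 2 else 0)) = 0 := by
      simp only [Finset.sum_sub_distrib]
      rw [hT, hE']
      linear_combination (-2 * (f i - f j)) * hbR
    have hnn : ∀ a k, 0 ≤ b a k * (f a - f k) ^ 2 -
        (if s(a, k) = s(i, j) then b a k * (f a - f k) ^ 2 else 0) := by
      intro a k
      split_ifs
      · rw [sub_self]
      · rw [sub_zero]; exact mul_nonneg (hb0 a k) (sq_nonneg _)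
    have hfe : f i = f j := by
      apply br_reach _ f _ hreach
      intro a k hak
      rw [SimpleGraph.deleteEdges_adj, Set.mem_singleton_iff] at hak
      rw [Finset.sum_eq_zero_iff_of_nonneg
        (fun a _ => Finset.sum_nonneg fun k _ => hnn a k)] at hS
      have h5 := hS a (Finset.mem_univ a)
      rw [Finset.sum_eq_zero_iff_of_nonneg (fun k _ => hnn a k)] at h5
      have h6 := h5 k (Finset.mem_univ k)
      rw [if_neg hak.2, sub_zero] at h6
      rcases mul_eq_zero.mp h6 with h7 | h7
      · exact absurd h7 (hpos a k hak.1).ne'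
      · exact sub_eq_zero.mp (pow_eq_zero_iff two_ne_zero |>.mp h7)
    rw [hfe, sub_self, zero_mul] at hbR
    exact zero_ne_one hbR
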